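/- Let n ≥ 1 and p ≥ 1, and suppose there exists an equilateral set of n+2 points in ℓ_p^n. Then 1 + 2/n ≤ n^{|1 − 4/p|}. -/

import Mathlib

open Finset

/-- The p-norm on `ℝ^n`. -/
noncomputable def pnorm (p : ℝ) {n : ℕ} (x : Fin n → ℝ) : ℝ :=
  (∑ i, |x i| ^ p) ^ (1 / p)

/-- A set `S ⊆ ℝ^n` is equilateral with respect to the p-norm if there is `λ > 0`
with `‖x - y‖_p = λ` for all distinct `x, y ∈ S`. -/
def IsEquilateral (p : ℝ) {n : ℕ} (S : Set (Fin n → ℝ)) : Prop :=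
  ∃ lam > 0, ∀ x ∈ S, ∀ y ∈ S, x ≠ y → pnorm p (x - y) = lam

theorem sum_rpow_le_rpow_sum {ι : Type*} (s : Finset ι) (u : ι → ℝ) (hu : ∀ i, 0 ≤ u i)
    {q : ℝ} (hq : 1 ≤ q) : ∑ i ∈ s, u i ^ q ≤ (∑ i ∈ s, u i) ^ q := by
  classical
  induction s using Finset.induction_on with
  | empty => simp [Real.zero_rpow (by linarith : q ≠ 0)]
  | insert a s ha ih =>
    rw [sum_insert ha, sum_insert ha]
    exact (add_le_add_right ih _).trans
      (Real.add_rpow_le_rpow_add (hu a) (sum_nonneg fun i _ => hu i) hq)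

theorem rpow_sum_le_card_rpow_mul {n : ℕ} (u : Fin n → ℝ) (hu : ∀ i, 0 ≤ u i)
    {q : ℝ} (hq : 1 ≤ q) : (∑ i, u i) ^ q ≤ (n : ℝ) ^ (q - 1) * ∑ i, u i ^ q := by
  simpa using Real.rpow_sum_le_const_mul_sum_rpow_of_nonneg univ hq fun i _ => hu i

/-- Comparison of the `4`-norm with the `p`-norm on a `p`-sphere. -/
theorem exists_sum_pow_four_bounds {n : ℕ} (hn : 1 ≤ n) {p : ℝ} (hp : 1 ≤ p) {L : ℝ}
    (hL : 0 < L) : ∃ a > 0, ∀ x : Fin n → ℝ, ∑ i, |x i| ^ p = L →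
      a ≤ ∑ i, x i ^ 4 ∧ ∑ i, x i ^ 4 ≤ a * (n : ℝ) ^ |1 - 4 / p| := by
  have hn0 : (0 : ℝ) < n := by exact_mod_cast hn
  have hp0 : 0 < p := by linarith
  rcases le_total p 4 with h4 | h4
  · have hq : 1 ≤ 4 / p := by rwa [one_le_div hp0]
    have hN : 0 < (n : ℝ) ^ (4 / p - 1) := Real.rpow_pos_of_pos hn0 _
    refine ⟨L ^ (4 / p) / (n : ℝ) ^ (4 / p - 1), by positivity, fun x hx => ?_⟩
    have hterm : ∀ i, (|x i| ^ p) ^ (4 / p) = x i ^ 4 := fun i => by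
      rw [← Real.rpow_mul (abs_nonneg _), mul_div_cancel₀ _ hp0.ne']
      norm_cast
      exact Even.pow_abs (by decide) _
    have h1 := sum_rpow_le_rpow_sum univ (fun i => |x i| ^ p) (fun i => by positivity) hq
    have h2 := rpow_sum_le_card_rpow_mul (fun i => |x i| ^ p) (fun i => by positivity) hq
    simp only [hterm, hx] at h1 h2
    rw [abs_of_nonpos (by linarith), neg_sub, div_mul_cancel₀ _ hN.ne']
    exact ⟨(div_le_iff₀' hN).2 h2, h1⟩
  · have hr : 1 ≤ p / 4 := by linarith
    have hr' : 0 ≤ 4 / p := by positivity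
    refine ⟨L ^ (4 / p), by positivity, fun x hx => ?_⟩
    have hterm : ∀ i, (x i ^ 4) ^ (p / 4) = |x i| ^ p := fun i => by
      rw [← Even.pow_abs (by decide : Even 4) (x i), ← Real.rpow_natCast,
        ← Real.rpow_mul (abs_nonneg _)]
      congr 1
      push_cast
      ring
    have h1 := sum_rpow_le_rpow_sum univ (fun i => x i ^ 4) (fun i => by positivity) hr
    have h2 := rpow_sum_le_card_rpow_mul (fun i => x i ^ 4) (fun i => by positivity) hr
    simp only [hterm, hx] at h1 h2
    have hA : 0 ≤ ∑ i, x i ^ 4 := sum_nonneg fun i _ => by positivity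
    have hcancel : p / 4 * (4 / p) = 1 := by field_simp
    have hroot : ((∑ i, x i ^ 4) ^ (p / 4)) ^ (4 / p) = ∑ i, x i ^ 4 := by
      rw [← Real.rpow_mul hA, hcancel, Real.rpow_one]
    have hle : 4 / p ≤ 1 := by rwa [div_le_one hp0]
    rw [abs_of_nonneg (by linarith)]
    constructor
    · simpa only [hroot] using Real.rpow_le_rpow hL.le h1 hr'
    · have h3 := Real.rpow_le_rpow (by positivity) h2 hr'
      rwa [hroot, Real.mul_rpow (by positivity) hL.le, ← Real.rpow_mul hn0.le, sub_mul,
        hcancel, one_mul, mul_comm] at h3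

/-- The quartic kernel `(s - t) ^ 4` is nonnegative definite on weights annihilating the
affine functions. -/
theorem sum_mul_sub_pow_four_nonneg {ι : Type*} (s : Finset ι) (c t : ι → ℝ)
    (h0 : ∑ i ∈ s, c i = 0) (h1 : ∑ i ∈ s, c i * t i = 0) :
    0 ≤ ∑ i ∈ s, ∑ j ∈ s, c i * c j * (t i - t j) ^ 4 := by
  have hinner : ∀ i, ∑ j ∈ s, c i * c j * (t i - t j) ^ 4 =
      6 * (c i * t i ^ 2) * (∑ j ∈ s, c j * t j ^ 2)
        - 4 * (c i * t i) * (∑ j ∈ s, c j * t j ^ 3) + c i * ∑ j ∈ s, c j * t j ^ 4 := fun i => by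
    have : ∀ j, c i * c j * (t i - t j) ^ 4 =
        c i * t i ^ 4 * c j - 4 * (c i * t i ^ 3) * (c j * t j)
          + 6 * (c i * t i ^ 2) * (c j * t j ^ 2)
          - 4 * (c i * t i) * (c j * t j ^ 3) + c i * (c j * t j ^ 4) := fun j => by ring
    simp only [this, sum_add_distrib, sum_sub_distrib, ← mul_sum, h0, h1]
    ring
  simp only [hinner, sum_add_distrib, sum_sub_distrib, ← sum_mul, ← mul_sum, h0, h1]
  nlinarith [sq_nonneg (∑ j ∈ s, c j * t j ^ 2)]

/-- A quadratic form with zero diagonal and off-diagonal entries in `[a, b]`, evaluated at weights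
of total mass zero. -/
theorem two_mul_sum_le_of_entries_mem_Icc {ι : Type*} (s : Finset ι) (c : ι → ℝ)
    (h0 : ∑ i ∈ s, c i = 0) (A : ι → ι → ℝ) {a b : ℝ} (hab : a ≤ b)
    (hdiag : ∀ i ∈ s, A i i = 0)
    (hoff : ∀ i ∈ s, ∀ j ∈ s, i ≠ j → a ≤ A i j ∧ A i j ≤ b) :
    2 * ∑ i ∈ s, ∑ j ∈ s, c i * c j * A i j ≤
      ((b - a) * #s - 2 * b) * ∑ i ∈ s, c i ^ 2 := by
  classical
  have hentry : ∀ i ∈ s, ∀ j ∈ s, 2 * (c i * c j * A i j) ≤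
      (a + b) * (c i * c j) + (b - a) * (|c i| * |c j|)
        - (if i = j then 2 * b * c i ^ 2 else 0) := by
    intro i hi j hj
    rw [← abs_mul]
    split_ifs with hij
    · subst hij
      rw [hdiag i hi, abs_mul_self]
      linarith
    · obtain ⟨hl, hu⟩ := hoff i hi j hj hij
      rcases le_total 0 (c i * c j) with h | h
      · rw [abs_of_nonneg h]
        nlinarith
      · rw [abs_of_nonpos h]
        nlinarith
  have hsum := sum_le_sum fun i hi => sum_le_sum (hentry i hi)
  simp only [sum_add_distrib, sum_sub_distrib, ← mul_sum, ← sum_mul, h0, sum_ite_eq] at hsum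
  rw [sum_ite_mem, inter_self, ← mul_sum] at hsum
  have hcs := sq_sum_le_card_mul_sum_sq (s := s) (f := fun i => |c i|)
  simp only [sq_abs] at hcs
  nlinarith [mul_le_mul_of_nonneg_left hcs (sub_nonneg.2 hab)]

/-- If there is an equilateral set of `n + 2` points in `ℓ_p^n`, then
`1 + 2/n ≤ n^{|1 - 4/p|}`. -/
theorem stmt13 (n : ℕ) (hn : 1 ≤ n) (p : ℝ) (hp : 1 ≤ p)
    (h : ∃ S : Finset (Fin n → ℝ), S.card = n + 2 ∧
      IsEquilateral p (S : Set (Fin n → ℝ))) :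
    1 + 2 / (n : ℝ) ≤ (n : ℝ) ^ |1 - 4 / p| := by
  obtain ⟨S, hS, lam, hlam, hdist⟩ := h
  have hn1 : (1 : ℝ) ≤ n := by exact_mod_cast hn
  have hp0 : p ≠ 0 := by linarith
  obtain ⟨a, ha, hbounds⟩ := exists_sum_pow_four_bounds hn hp (Real.rpow_pos_of_pos hlam p)
  obtain ⟨c, hc1, hc0, e, heS, hce⟩ :=
    Module.exists_nontrivial_relation_sum_zero_of_finrank_succ_lt_card (R := ℝ) (t := S)
      (by rw [hS, Module.finrank_fin_fun]; omega)
  set N := (n : ℝ) ^ |1 - 4 / p|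
  have hN : 1 ≤ N := Real.one_le_rpow hn1 (abs_nonneg _)
  have hupper := two_mul_sum_le_of_entries_mem_Icc S c hc0
    (fun x y => ∑ k, (x k - y k) ^ 4) (le_mul_of_one_le_right ha.le hN) (by simp)
    (fun x hx y hy hxy => hbounds (x - y) (by
      rw [← hdist x hx y hy hxy, pnorm, ← Real.rpow_mul (by positivity), one_div_mul_cancel hp0,
        Real.rpow_one]))
  have hlower : 0 ≤ ∑ x ∈ S, ∑ y ∈ S, c x * c y * ∑ k, (x k - y k) ^ 4 := by
    have hswap : ∑ x ∈ S, ∑ y ∈ S, c x * c y * ∑ k, (x k - y k) ^ 4 =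
        ∑ k, ∑ x ∈ S, ∑ y ∈ S, c x * c y * (x k - y k) ^ 4 := by
      rw [sum_comm]
      simp only [mul_sum]
      rw [sum_comm]
      simp only [sum_comm (s := S) (t := univ)]
    rw [hswap]
    refine sum_nonneg fun k _ => sum_mul_sub_pow_four_nonneg S c (fun x => x k) hc0 ?_
    simpa using congrFun hc1 k
  have hpos : 0 < ∑ x ∈ S, c x ^ 2 :=
    sum_pos' (fun x _ => sq_nonneg _) ⟨e, heS, by positivity⟩
  have hcoef : 0 ≤ (a * N - a) * #S - 2 * (a * N) :=
    nonneg_of_mul_nonneg_left (by linarith) hpos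
  rw [hS] at hcoef
  push_cast at hcoef
  have hfin : 0 ≤ N * n - n - 2 := nonneg_of_mul_nonneg_right (by linarith) ha
  rw [← sub_nonneg, show N - (1 + 2 / (n : ℝ)) = (N * n - n - 2) / n by field_simp; ring]
  positivity
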